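/- For every nonzero c ∈ ℤ[i], Σ_{c₁²c₂c₃ = c} μ(c₂)·φ(c₃)/N(c₃) = Σ_{c₁²c₂ = c} μ(c₂)/N(c₂), where the left-hand sum runs over factorizations of the ideal (c) as (c₁)²(c₂)(c₃) and the right-hand sum over factorizations of (c) as (c₁)²(c₂) (equivalently, over factorizations in ℤ[i] counted up to units). -/

import Mathlib

noncomputable section

namespace PGT

def Gnorm (n : GaussianInt) : ℕ := (Zsqrtd.norm n).natAbs

def Gphi (c : GaussianInt) : ℕ :=
  Nat.card (GaussianInt ⧸ Ideal.span ({c} : Set GaussianInt))ˣ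

def rhoc (c δ : GaussianInt) : ℕ :=
  Nat.card {x : GaussianInt ⧸ Ideal.span ({2 * c} : Set GaussianInt) //
    ∃ y : GaussianInt, Ideal.Quotient.mk (Ideal.span ({2 * c} : Set GaussianInt)) y = x ∧
      4 * c ∣ y ^ 2 - δ}

def rhoG (c a : GaussianInt) : ℕ :=
  Nat.card {d : GaussianInt ⧸ Ideal.span ({c} : Set GaussianInt) //
    d ^ 2 - (Ideal.Quotient.mk (Ideal.span ({c} : Set GaussianInt)) a) * d + 1 = 0}

def NStar (c : GaussianInt) : ℕ :=
  sSup {m : ℕ | ∃ d : GaussianInt, d ^ 2 ∣ c ∧ m = Gnorm d}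

open Classical in
def muG (c : GaussianInt) : ℤ :=
  if Squarefree c then (-1) ^ (UniqueFactorizationMonoid.factors c).card else 0

def genG (I : Ideal GaussianInt) : GaussianInt := Submodule.IsPrincipal.generator I

def lamc (c δ : GaussianInt) : ℤ :=
  ∑ᶠ t ∈ {t : Ideal GaussianInt × Ideal GaussianInt × Ideal GaussianInt |
      t.1 ^ 2 * t.2.1 * t.2.2 = Ideal.span ({c} : Set GaussianInt)},
    muG (genG t.2.1) * (rhoc (genG t.2.2) δ : ℤ)

open Classical in
def legG (p x : GaussianInt) : ℤ :=
  if p ∣ x then 0 else if ∃ y : GaussianInt, p ∣ y ^ 2 - x then 1 else -1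

def quadSym (r x : GaussianInt) : ℤ :=
  ((UniqueFactorizationMonoid.factors r).map (fun p => legG p x)).prod

def muTilde (r : GaussianInt) : ℤ :=
  ∑ᶠ a : GaussianInt ⧸ Ideal.span ({r} : Set GaussianInt),
    quadSym r ((Quotient.out a) ^ 2 - 4)

def tauI (n : GaussianInt) : ℕ :=
  Nat.card {I : Ideal GaussianInt // I ∣ Ideal.span ({n} : Set GaussianInt)}

def zetaQi : ℝ := (1 / 4) * ∑' n : {n : GaussianInt // n ≠ 0}, 1 / ((Gnorm n.1 : ℝ)) ^ 2

def eG (t : ℝ) : ℂ := Complex.exp (2 * Real.pi * Complex.I * t)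

def kloost (m n c : GaussianInt) : ℂ :=
  ∑ᶠ a : (GaussianInt ⧸ Ideal.span ({c} : Set GaussianInt))ˣ,
    eG ((GaussianInt.toComplex
        (m * Quotient.out ((a : GaussianInt ⧸ Ideal.span ({c} : Set GaussianInt))) +
         n * Quotient.out (((a⁻¹ : (GaussianInt ⧸ Ideal.span ({c} : Set GaussianInt))ˣ) :
            GaussianInt ⧸ Ideal.span ({c} : Set GaussianInt)))) /
      GaussianInt.toComplex c).re)


section Convolution

variable {R : Type*} [CommRing R] [IsDedekindDomain R]

theorem finite_setOf_dvd {I : Ideal R} (hI : I ≠ 0) : {A : Ideal R | A ∣ I}.Finite :=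
  @Set.toFinite _ _ (@Finite.of_fintype _ (UniqueFactorizationMonoid.fintypeSubtypeDvd I hI))

theorem finite_setOf_mul_eq {I : Ideal R} (hI : I ≠ 0) :
    {p : Ideal R × Ideal R | p.1 * p.2 = I}.Finite :=
  ((finite_setOf_dvd hI).prod (finite_setOf_dvd hI)).subset
    fun _ hp => ⟨Dvd.intro _ hp, Dvd.intro_left _ hp⟩

theorem finite_setOf_sq_mul_eq {I : Ideal R} (hI : I ≠ 0) :
    {p : Ideal R × Ideal R | p.1 ^ 2 * p.2 = I}.Finite :=
  ((finite_setOf_dvd hI).prod (finite_setOf_dvd hI)).subset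
    fun p hp => ⟨(dvd_pow_self p.1 two_ne_zero).trans (Dvd.intro _ hp), Dvd.intro_left _ hp⟩

theorem finite_setOf_sq_mul_mul_eq {I : Ideal R} (hI : I ≠ 0) :
    {t : Ideal R × Ideal R × Ideal R | t.1 ^ 2 * t.2.1 * t.2.2 = I}.Finite := by
  refine ((finite_setOf_dvd hI).prod
    ((finite_setOf_dvd hI).prod (finite_setOf_dvd hI))).subset ?_
  rintro ⟨a, b, c⟩ rfl
  exact ⟨(dvd_pow_self a two_ne_zero).trans ((dvd_mul_right _ b).mul_right c),
    (dvd_mul_left b _).mul_right c, dvd_mul_left c _⟩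

/-- Dirichlet convolution of functions on ideals. -/
def idealConv (f g : Ideal R → ℝ) (I : Ideal R) : ℝ :=
  ∑ᶠ p ∈ {p : Ideal R × Ideal R | p.1 * p.2 = I}, f p.1 * g p.2

theorem idealConv_eq_sum (f g : Ideal R → ℝ) {I : Ideal R} (hI : I ≠ 0) :
    idealConv f g I = ∑ p ∈ (finite_setOf_mul_eq hI).toFinset, f p.1 * g p.2 :=
  finsum_mem_eq_finite_toFinset_sum _ _

/-- Multiplicativity on coprime nonzero ideals. -/
def IsMultiplicativeOnIdeals (f : Ideal R → ℝ) : Prop :=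
  ∀ I J : Ideal R, I ≠ 0 → J ≠ 0 → IsCoprime I J → f (I * J) = f I * f J

theorem eq_and_eq_of_mul_eq_mul_of_isCoprime {A A' B B' I J : Ideal R}
    (hIJ : IsCoprime I J) (hA : A ∣ I) (hA' : A' ∣ I) (hB : B ∣ J) (hB' : B' ∣ J)
    (h : A * B = A' * B') : A = A' ∧ B = B' := by
  have key : ∀ {X X' Y Y' K L : Ideal R}, IsCoprime K L → X ∣ K → Y' ∣ L →
      X * Y = X' * Y' → X ∣ X' := by
    intro X X' Y Y' K L hKL hX hY' h
    exact ((hKL.of_isCoprime_of_dvd_left hX).of_isCoprime_of_dvd_right hY').dvd_of_dvd_mul_right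
      (h ▸ dvd_mul_right X Y)
  refine ⟨dvd_antisymm (key hIJ hA hB' h) (key hIJ hA' hB h.symm), ?_⟩
  rw [mul_comm A, mul_comm A'] at h
  exact dvd_antisymm (key hIJ.symm hB hA' h) (key hIJ.symm hB' hA h.symm)

theorem IsMultiplicativeOnIdeals.idealConv {f g : Ideal R → ℝ}
    (hf : IsMultiplicativeOnIdeals f) (hg : IsMultiplicativeOnIdeals g) :
    IsMultiplicativeOnIdeals (idealConv f g) := by
  intro I J hI hJ hIJ
  rw [idealConv_eq_sum f g hI, idealConv_eq_sum f g hJ, idealConv_eq_sum f g (mul_ne_zero hI hJ),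
    Finset.sum_mul_sum, ← Finset.sum_product']
  symm
  refine Finset.sum_bij (fun q _ => (q.1.1 * q.2.1, q.1.2 * q.2.2)) ?_ ?_ ?_ ?_
  · rintro ⟨⟨A, B⟩, ⟨A', B'⟩⟩ h
    simp only [Finset.mem_product, Set.Finite.mem_toFinset, Set.mem_ofPred_eq] at h ⊢
    rw [← h.1, ← h.2]
    ring
  · rintro ⟨⟨A, B⟩, ⟨A', B'⟩⟩ h ⟨⟨C, D⟩, ⟨C', D'⟩⟩ h' e
    simp only [Finset.mem_product, Set.Finite.mem_toFinset, Set.mem_ofPred_eq] at h h'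
    simp only [Prod.mk.injEq] at e
    obtain ⟨h1, h2⟩ := eq_and_eq_of_mul_eq_mul_of_isCoprime hIJ (Dvd.intro _ h.1)
      (Dvd.intro _ h'.1) (Dvd.intro _ h.2) (Dvd.intro _ h'.2) e.1
    obtain ⟨h3, h4⟩ := eq_and_eq_of_mul_eq_mul_of_isCoprime hIJ (Dvd.intro_left _ h.1)
      (Dvd.intro_left _ h'.1) (Dvd.intro_left _ h.2) (Dvd.intro_left _ h'.2) e.2
    rw [h1, h2, h3, h4]
  · rintro ⟨A, B⟩ h
    simp only [Set.Finite.mem_toFinset, Set.mem_ofPred_eq] at h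
    obtain ⟨A₁, A₂, ⟨B₁, rfl⟩, ⟨B₂, rfl⟩, rfl⟩ := exists_dvd_and_dvd_of_dvd_mul (Dvd.intro _ h)
    refine ⟨((A₁, B₁), (A₂, B₂)), by simp, ?_⟩
    have hA : A₁ * A₂ ≠ 0 := mul_ne_zero (left_ne_zero_of_mul hI) (left_ne_zero_of_mul hJ)
    have : B = B₁ * B₂ := mul_left_cancel₀ hA (by rw [h]; ring)
    rw [this]
  · rintro ⟨⟨A, B⟩, ⟨A', B'⟩⟩ h
    simp only [Finset.mem_product, Set.Finite.mem_toFinset, Set.mem_ofPred_eq] at h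
    obtain ⟨rfl, rfl⟩ := h
    have hA := (hIJ.of_isCoprime_of_dvd_left (dvd_mul_right A B)).of_isCoprime_of_dvd_right
      (dvd_mul_right A' B')
    have hB := (hIJ.of_isCoprime_of_dvd_left (dvd_mul_left B A)).of_isCoprime_of_dvd_right
      (dvd_mul_left B' A')
    dsimp only
    rw [hf _ _ (left_ne_zero_of_mul hI) (left_ne_zero_of_mul hJ) hA,
      hg _ _ (right_ne_zero_of_mul hI) (right_ne_zero_of_mul hJ) hB]
    ring

theorem idealConv_prime_pow (f g : Ideal R → ℝ) {P : Ideal R} (hP : Prime P) (n : ℕ) :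
    idealConv f g (P ^ n) = ∑ q ∈ Finset.HasAntidiagonal.antidiagonal n, f (P ^ q.1) * g (P ^ q.2) := by
  have hinj := pow_injective_of_not_isUnit hP.not_isUnit hP.ne_zero
  rw [idealConv_eq_sum f g (pow_ne_zero n hP.ne_zero)]
  symm
  refine Finset.sum_bij (fun q _ => (P ^ q.1, P ^ q.2)) ?_ ?_ ?_ fun _ _ => rfl
  · rintro ⟨i, j⟩ h
    simp only [Finset.HasAntidiagonal.mem_antidiagonal] at h
    simp [← pow_add, h]
  · rintro ⟨i, j⟩ _ ⟨k, l⟩ _ e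
    simp only [Prod.mk.injEq] at e
    rw [hinj e.1, hinj e.2]
  · rintro ⟨A, B⟩ h
    simp only [Set.Finite.mem_toFinset, Set.mem_ofPred_eq] at h
    obtain ⟨i, -, hi⟩ := (dvd_prime_pow hP n).1 (Dvd.intro _ h)
    obtain ⟨j, -, hj⟩ := (dvd_prime_pow hP n).1 (Dvd.intro_left _ h)
    rw [associated_iff_eq] at hi hj
    subst hi hj
    exact ⟨(i, j), by simpa using hinj ((pow_add P i j).trans h), rfl⟩

theorem idealConv_one (f g : Ideal R → ℝ) : idealConv f g 1 = f 1 * g 1 := by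
  have h : {p : Ideal R × Ideal R | p.1 * p.2 = 1} = {(1, 1)} := by
    ext ⟨A, B⟩
    simp [-Ideal.one_eq_top, mul_eq_one]
  rw [idealConv, h, finsum_mem_singleton]

theorem eq_of_eq_on_prime_pow {f g : Ideal R → ℝ}
    (hf : IsMultiplicativeOnIdeals f) (hg : IsMultiplicativeOnIdeals g)
    (h : ∀ (P : Ideal R) (n : ℕ), Prime P → f (P ^ n) = g (P ^ n)) (h1 : f 1 = g 1)
    {I : Ideal R} (hI : I ≠ 0) : f I = g I := by
  induction I using UniqueFactorizationMonoid.induction_on_coprime with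
  | h0 => exact absurd rfl hI
  | h1 hx => rwa [Ideal.isUnit_iff.1 hx, ← Ideal.one_eq_top]
  | hpr i hp => exact h _ i hp
  | hcp hxy ihx ihy =>
    have hx := left_ne_zero_of_mul hI
    have hy := right_ne_zero_of_mul hI
    have hc := Ideal.isCoprime_iff_sup_eq.2 (Ideal.isUnit_iff.1
      (hxy (Ideal.dvd_iff_le.2 le_sup_left) (Ideal.dvd_iff_le.2 le_sup_right)))
    rw [hf _ _ hx hy hc, hg _ _ hx hy hc, ihx hx, ihy hy]

theorem finsum_sq_mul_mul (f g : Ideal R → ℝ) {I : Ideal R} (hI : I ≠ 0) :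
    ∑ᶠ t ∈ {t : Ideal R × Ideal R × Ideal R | t.1 ^ 2 * t.2.1 * t.2.2 = I}, f t.2.1 * g t.2.2 =
      ∑ᶠ p ∈ {p : Ideal R × Ideal R | p.1 ^ 2 * p.2 = I}, idealConv f g p.2 := by
  classical
  rw [finsum_mem_eq_finite_toFinset_sum _ (finite_setOf_sq_mul_mul_eq hI),
    finsum_mem_eq_finite_toFinset_sum _ (finite_setOf_sq_mul_eq hI),
    ← Finset.sum_fiberwise_of_maps_to (g := fun t => (t.1, t.2.1 * t.2.2))
      (t := (finite_setOf_sq_mul_eq hI).toFinset) (by simp [mul_assoc])]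
  refine Finset.sum_congr rfl ?_
  rintro ⟨A, B⟩ h
  simp only [Set.Finite.mem_toFinset, Set.mem_ofPred_eq] at h
  rw [idealConv_eq_sum f g (right_ne_zero_of_mul (h.trans_ne hI))]
  refine Finset.sum_bij' (fun t _ => t.2) (fun p _ => (A, p)) ?_ ?_ ?_ ?_ ?_
  · rintro ⟨a, b, c⟩ ht
    simp_all
  · rintro ⟨b, c⟩ hp
    simp_all [mul_assoc]
  · rintro ⟨a, b, c⟩ ht
    simp_all
  · simp
  · simp

end Convolution

section Units

variable {R : Type*} [CommRing R]

/-- The number of units of `R ⧸ I`. -/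
def idealTotient (I : Ideal R) : ℕ := Nat.card (R ⧸ I)ˣ

theorem idealTotient_mul_of_isCoprime {I J : Ideal R} (h : IsCoprime I J) :
    idealTotient (I * J) = idealTotient I * idealTotient J := by
  unfold idealTotient
  rw [← Nat.card_prod]
  exact Nat.card_congr ((Units.mapEquiv
    (Ideal.quotientMulEquivQuotientProd I J h).toMulEquiv).trans MulEquiv.prodUnits).toEquiv

theorem isUnit_mk_prime_pow_succ_iff [IsDedekindDomain R] {P : Ideal R} (hP : Prime P) (n : ℕ) (x : R) :
    IsUnit (Ideal.Quotient.mk (P ^ (n + 1)) x) ↔ x ∉ P := by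
  have hmax : P.IsMaximal := (Ideal.isPrime_of_prime hP).isMaximal hP.ne_zero
  constructor
  · intro hu hx
    have h := hu.map (Ideal.Quotient.factor (Ideal.pow_le_self n.succ_ne_zero : P ^ (n + 1) ≤ P))
    rw [Ideal.Quotient.factor_mk, Ideal.Quotient.eq_zero_iff_mem.2 hx] at h
    have := Ideal.Quotient.nontrivial_iff.2 hmax.ne_top
    exact not_isUnit_zero h
  · intro hx
    have hc : IsCoprime (P ^ (n + 1)) (Ideal.span {x}) := by
      refine IsCoprime.pow_left (Ideal.isCoprime_iff_sup_eq.2 ?_)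
      obtain ⟨y, i, hi, h⟩ := hmax.exists_inv hx
      rw [Ideal.eq_top_iff_one, ← h, add_comm]
      exact Submodule.add_mem_sup hi (Ideal.mem_span_singleton'.2 ⟨y, rfl⟩)
    obtain ⟨a, ha, b, hb, hab⟩ := Ideal.isCoprime_iff_exists.1 hc
    obtain ⟨y, rfl⟩ := Ideal.mem_span_singleton'.1 hb
    refine IsUnit.of_mul_eq_one (Ideal.Quotient.mk _ y) ?_
    rw [← map_mul, ← map_one (Ideal.Quotient.mk (P ^ (n + 1))), Ideal.Quotient.eq,
      ← hab]
    have : x * y - (a + y * x) = - a := by ring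
    rw [this]
    exact neg_mem ha

theorem idealTotient_prime_pow_succ [IsDedekindDomain R] [Module.Free ℤ R]
    {P : Ideal R} (hP : Prime P) (n : ℕ) (h0 : Ideal.absNorm P ≠ 0) :
    (idealTotient (P ^ (n + 1)) : ℝ) =
      (Ideal.absNorm (P ^ (n + 1)) : ℝ) - (Ideal.absNorm (P ^ n) : ℝ) := by
  have hfin : Finite (R ⧸ P ^ (n + 1)) := by
    apply Nat.finite_of_card_ne_zero
    change Ideal.absNorm (P ^ (n + 1)) ≠ 0
    rw [map_pow]; exact pow_ne_zero _ h0
  have hle : P ^ (n + 1) ≤ P := Ideal.pow_le_self n.succ_ne_zero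
  let K := RingHom.ker (Ideal.Quotient.factor hle)
  have hK : Nat.card K = Ideal.absNorm (P ^ n) := by
    have h1 := K.toAddSubgroup.card_mul_index
    have h2 : K.toAddSubgroup.index = Ideal.absNorm P := by
      change Nat.card (_ ⧸ K) = Nat.card (R ⧸ P)
      exact Nat.card_congr (RingHom.quotientKerEquivOfSurjective
        (Ideal.Quotient.factor_surjective hle)).toEquiv
    have h3 : Nat.card (R ⧸ P ^ (n + 1)) = Ideal.absNorm (P ^ n) * Ideal.absNorm P := by
      change Ideal.absNorm (P ^ (n + 1)) = _
      rw [pow_succ, map_mul]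
    rw [h2, h3] at h1
    exact Nat.eq_of_mul_eq_mul_right (Nat.pos_of_ne_zero h0) h1
  have hU : ∀ x : R ⧸ P ^ (n + 1), IsUnit x ↔ x ∉ (K : Set (R ⧸ P ^ (n + 1))) := by
    intro x
    obtain ⟨x, rfl⟩ := Ideal.Quotient.mk_surjective x
    rw [isUnit_mk_prime_pow_succ_iff hP, SetLike.mem_coe, RingHom.mem_ker,
      Ideal.Quotient.factor_mk, Ideal.Quotient.eq_zero_iff_mem]
  have hcard : idealTotient (P ^ (n + 1)) = (K : Set (R ⧸ P ^ (n + 1)))ᶜ.ncard := by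
    rw [← Nat.card_coe_set_eq]
    refine Nat.card_congr (Equiv.ofBijective (fun u => ⟨u, (hU u).1 u.isUnit⟩) ⟨?_, ?_⟩)
    · intro u v h
      exact Units.ext (congrArg Subtype.val h)
    · rintro ⟨x, hx⟩
      exact ⟨((hU x).2 hx).unit, rfl⟩
  have hsum := Set.ncard_add_ncard_compl (K : Set (R ⧸ P ^ (n + 1)))
  rw [← hcard, ← Nat.card_coe_set_eq] at hsum
  rw [eq_sub_iff_add_eq']
  norm_cast
  rw [← hK]
  exact hsum

end Units

section Gaussian

theorem muG_eq_of_associated {a b : GaussianInt} (h : Associated a b) : muG a = muG b := by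
  unfold muG
  rw [h.squarefree_iff, Multiset.card_eq_card_of_rel
    (UniqueFactorizationMonoid.factors_rel_of_associated h)]

theorem muG_one : muG 1 = 1 := by
  simp [muG]

theorem muG_prime {p : GaussianInt} (hp : Prime p) : muG p = -1 := by
  obtain ⟨q, -, hq⟩ := prime_factors_irreducible hp.irreducible
    ⟨fun _ => UniqueFactorizationMonoid.prime_of_factor _,
      UniqueFactorizationMonoid.factors_prod hp.ne_zero⟩
  simp [muG, hp.irreducible.squarefree, hq]

theorem muG_mul {a b : GaussianInt} (ha : a ≠ 0) (hb : b ≠ 0) (h : IsRelPrime a b) :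
    muG (a * b) = muG a * muG b := by
  unfold muG
  rw [Multiset.card_eq_card_of_rel (UniqueFactorizationMonoid.factors_mul ha hb),
    squarefree_mul_iff]
  by_cases h1 : Squarefree a <;> by_cases h2 : Squarefree b <;> simp [h, h1, h2, pow_add]

theorem span_genG (I : Ideal GaussianInt) : Ideal.span {genG I} = I :=
  Ideal.span_singleton_generator I

theorem genG_mul (I J : Ideal GaussianInt) : Associated (genG (I * J)) (genG I * genG J) := by
  rw [← Ideal.span_singleton_eq_span_singleton, ← Ideal.span_singleton_mul_span_singleton]
  simp only [span_genG]

theorem genG_ne_zero {I : Ideal GaussianInt} (hI : I ≠ 0) : genG I ≠ 0 := by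
  intro h
  apply hI
  have := span_genG I
  rw [h] at this
  simpa using this.symm

theorem muG_genG_top : muG (genG ⊤) = 1 := by
  refine (muG_eq_of_associated ?_).trans muG_one
  rw [← Ideal.span_singleton_eq_span_singleton, span_genG]
  simp

theorem muG_genG_mul {I J : Ideal GaussianInt} (hI : I ≠ 0) (hJ : J ≠ 0) (h : IsCoprime I J) :
    muG (genG (I * J)) = muG (genG I) * muG (genG J) := by
  rw [muG_eq_of_associated (genG_mul I J)]
  apply muG_mul (genG_ne_zero hI) (genG_ne_zero hJ)
  rw [← span_genG I, ← span_genG J, Ideal.isCoprime_span_singleton_iff] at h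
  exact h.isRelPrime

theorem muG_genG_prime {P : Ideal GaussianInt} (hP : Prime P) : muG (genG P) = -1 := by
  apply muG_prime
  rw [← Ideal.span_singleton_prime (genG_ne_zero hP.ne_zero), span_genG]
  exact Ideal.isPrime_of_prime hP

theorem muG_genG_prime_pow {P : Ideal GaussianInt} (hP : Prime P) (n : ℕ) :
    muG (genG (P ^ (n + 2))) = 0 := by
  have h : Associated (genG (P ^ (n + 2))) (genG P * genG P * genG (P ^ n)) := by
    rw [← Ideal.span_singleton_eq_span_singleton, ← Ideal.span_singleton_mul_span_singleton,
      ← Ideal.span_singleton_mul_span_singleton]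
    simp only [span_genG]
    ring
  unfold muG
  rw [if_neg]
  intro hs
  have hu := hs (genG P) ((dvd_mul_right _ _).trans h.symm.dvd)
  rw [← Ideal.span_singleton_eq_top, span_genG, ← Ideal.one_eq_top] at hu
  exact hP.ne_one hu

/-- The standard basis `1, i` of the Gaussian integers. -/
def gaussianBasis : Module.Basis (Fin 2) ℤ GaussianInt :=
  Module.Basis.ofEquivFun
    { toFun := fun z => ![z.re, z.im]
      invFun := fun v => ⟨v 0, v 1⟩
      map_add' := fun x y => by ext i; fin_cases i <;> simp
      map_smul' := fun n x => by ext i; fin_cases i <;> simp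
      left_inv := fun x => by ext <;> simp
      right_inv := fun v => by ext i; fin_cases i <;> simp }

instance : Module.Free ℤ GaussianInt := Module.Free.of_basis gaussianBasis

instance : Module.Finite ℤ GaussianInt := Module.Finite.of_basis gaussianBasis

theorem algebra_norm_gaussianInt (z : GaussianInt) : Algebra.norm ℤ z = Zsqrtd.norm z := by
  rw [Algebra.norm_eq_matrix_det gaussianBasis, Matrix.det_fin_two]
  simp [Algebra.leftMulMatrix_eq_repr_mul, gaussianBasis, Zsqrtd.norm_def]

theorem Gnorm_genG (I : Ideal GaussianInt) : Gnorm (genG I) = Ideal.absNorm I := by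
  conv_rhs => rw [← span_genG I, Ideal.absNorm_span_singleton, algebra_norm_gaussianInt]
  rfl

theorem Gphi_genG (I : Ideal GaussianInt) : Gphi (genG I) = idealTotient I := by
  rw [Gphi, span_genG, idealTotient]

theorem absNorm_ne_zero {I : Ideal GaussianInt} (hI : I ≠ 0) : (Ideal.absNorm I : ℝ) ≠ 0 := by
  exact_mod_cast Ideal.absNorm_eq_zero_iff.not.2 hI

theorem idealConv_muG_totient {I : Ideal GaussianInt} (hI : I ≠ 0) :
    idealConv (fun A => (muG (genG A) : ℝ))
      (fun B => (Gphi (genG B) : ℝ) / (Gnorm (genG B) : ℝ)) I =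
        (muG (genG I) : ℝ) / (Gnorm (genG I) : ℝ) := by
  have hmu : IsMultiplicativeOnIdeals (fun A => (muG (genG A) : ℝ)) := by
    intro I J hI hJ h
    simp only [muG_genG_mul hI hJ h, Int.cast_mul]
  have hphi : IsMultiplicativeOnIdeals
      (fun B => (Gphi (genG B) : ℝ) / (Gnorm (genG B) : ℝ)) := by
    intro I J hI hJ h
    simp only [Gphi_genG, Gnorm_genG, idealTotient_mul_of_isCoprime h, map_mul, Nat.cast_mul,
      mul_div_mul_comm]
  have hright : IsMultiplicativeOnIdeals
      (fun I => (muG (genG I) : ℝ) / (Gnorm (genG I) : ℝ)) := by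
    intro I J hI hJ h
    simp only [muG_genG_mul hI hJ h, Gnorm_genG, map_mul, Int.cast_mul, Nat.cast_mul,
      mul_div_mul_comm]
  have hphi1 : (idealTotient (⊤ : Ideal GaussianInt) : ℝ) = 1 := by
    have : Subsingleton (GaussianInt ⧸ (⊤ : Ideal GaussianInt)) :=
      Ideal.Quotient.subsingleton_iff.2 rfl
    simp [idealTotient]
  have hpow : ∀ (P : Ideal GaussianInt) (n : ℕ), Prime P →
      idealConv (fun A => (muG (genG A) : ℝ))
        (fun B => (Gphi (genG B) : ℝ) / (Gnorm (genG B) : ℝ)) (P ^ n) =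
          (muG (genG (P ^ n)) : ℝ) / (Gnorm (genG (P ^ n)) : ℝ) := by
    intro P n hP
    have h0 := absNorm_ne_zero hP.ne_zero
    have h0' : Ideal.absNorm P ≠ 0 := by exact_mod_cast h0
    rw [idealConv_prime_pow _ _ hP]
    simp only [Gphi_genG, Gnorm_genG]
    obtain _ | _ | n := n
    · simp [hphi1, muG_genG_top]
    · simp only [zero_add, Finset.Nat.antidiagonal_succ, Finset.Nat.antidiagonal_zero,
        Finset.sum_cons, Finset.sum_singleton, Finset.map_singleton]
      have := idealTotient_prime_pow_succ hP 0 h0'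
      simp only [zero_add, pow_one, pow_zero, map_one, Nat.cast_one] at this
      simp [this, hphi1, muG_genG_top, muG_genG_prime hP]
      field_simp
      ring
    · simp only [Finset.Nat.antidiagonal_succ, Finset.sum_cons, Finset.sum_map,
        Finset.map_cons, Finset.map_map, Function.Embedding.prodMap, Function.Embedding.coeFn_mk,
        Function.Embedding.trans_apply, Prod.map, Function.Embedding.refl_apply]
      simp [muG_genG_top, muG_genG_prime hP, muG_genG_prime_pow hP,
        idealTotient_prime_pow_succ hP _ h0']
      field_simp
      ring
  refine eq_of_eq_on_prime_pow (hmu.idealConv hphi) hright hpow ?_ hI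
  rw [idealConv_one]
  simp [Gphi_genG, Gnorm_genG, hphi1]

end Gaussian

theorem stmt13 : ∀ c : GaussianInt, c ≠ 0 →
    (∑ᶠ t ∈ {t : Ideal GaussianInt × Ideal GaussianInt × Ideal GaussianInt |
        t.1 ^ 2 * t.2.1 * t.2.2 = Ideal.span ({c} : Set GaussianInt)},
      (muG (genG t.2.1) : ℝ) * (Gphi (genG t.2.2) : ℝ) / (Gnorm (genG t.2.2) : ℝ)) =
    ∑ᶠ p ∈ {p : Ideal GaussianInt × Ideal GaussianInt |
        p.1 ^ 2 * p.2 = Ideal.span ({c} : Set GaussianInt)},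
      (muG (genG p.2) : ℝ) / (Gnorm (genG p.2) : ℝ) := by
  intro c hc
  have hI : Ideal.span ({c} : Set GaussianInt) ≠ 0 := by
    simpa [Ideal.span_singleton_eq_bot] using hc
  simp only [mul_div_assoc]
  rw [finsum_sq_mul_mul (fun A => (muG (genG A) : ℝ))
    (fun B => (Gphi (genG B) : ℝ) / (Gnorm (genG B) : ℝ)) hI]
  refine finsum_mem_congr rfl fun p hp => ?_
  exact idealConv_muG_totient (right_ne_zero_of_mul (hp.trans_ne hI))

end PGT
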